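/- Suppose a finite connected weighted graph G is the pointed sum (wedge) of two subgraphs G₁ and G₂ meeting in a single vertex p. Then there is a canonical isomorphism Pic(G) ≅ Pic(G₁) × Pic(G₂) (equivalently, J(G) ≅ J(G₁) × J(G₂)). -/

import Mathlib

/-- A finite weighted (multi)graph with a fixed orientation of the edges:
vertex type `V`, edge type `E`, tail/head maps and a positive length function. -/
structure WGraph where
  V : Type
  E : Type
  [fV : Fintype V]
  [fE : Fintype E]
  [dV : DecidableEq V]
  [dE : DecidableEq E]
  tail : E → V
  head : E → V
  len : E → ℝ
  len_pos : ∀ e, 0 < len e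

attribute [instance] WGraph.fV WGraph.fE WGraph.dV WGraph.dE

namespace WGraph

variable (G : WGraph)

/-- Two vertices are adjacent if some edge joins them (in either direction). -/
def Adj (x y : G.V) : Prop :=
  ∃ e, (G.tail e = x ∧ G.head e = y) ∨ (G.tail e = y ∧ G.head e = x)

/-- A weighted graph is connected if any two vertices are joined by a walk. -/
def Connected : Prop := ∀ x y : G.V, Relation.ReflTransGen G.Adj x y

/-- The differential `d : C_0(G,ℝ) → C_1(G,ℝ)`, `(df)(e) = (f(e⁺) - f(e⁻))/ℓ(e)`. -/
noncomputable def d (f : G.V → ℝ) : G.E → ℝ :=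
  fun e => (f (G.head e) - f (G.tail e)) / G.len e

/-- The adjoint `d* : C_1(G,ℝ) → C_0(G,ℝ)`,
`(d*α)(x) = Σ_{e⁺ = x} α(e) - Σ_{e⁻ = x} α(e)`. -/
def dStar (α : G.E → ℝ) : G.V → ℝ := fun x =>
  (∑ e ∈ Finset.univ.filter fun e => G.head e = x, α e) -
    ∑ e ∈ Finset.univ.filter fun e => G.tail e = x, α e

/-- The inner product `⟨α,β⟩ = Σ_e α(e) β(e) ℓ(e)` on real 1-chains. -/
noncomputable def ip (α β : G.E → ℝ) : ℝ := ∑ e, α e * β e * G.len e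

/-- Real 1-cycles: the kernel of `d*`. -/
def IsCycle (α : G.E → ℝ) : Prop := ∀ x, G.dStar α x = 0

/-- Exact 1-chains: the image of `d`. -/
def IsExact (α : G.E → ℝ) : Prop := ∃ f : G.V → ℝ, α = G.d f

/-- A 1-form `ω = Σ ω_e de` (recorded by its coefficients) is harmonic if at every
vertex the incoming and outgoing coefficients sum to the same value. -/
def Harmonic (ω : G.E → ℝ) : Prop :=
  ∀ x, (∑ e ∈ Finset.univ.filter fun e => G.head e = x, ω e) =
    ∑ e ∈ Finset.univ.filter fun e => G.tail e = x, ω e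

/-- Integration of the 1-form `ω` along the 1-chain `α`: `∫_α ω = Σ_e ω_e α(e) ℓ(e)`. -/
noncomputable def intPair (ω α : G.E → ℝ) : ℝ := ∑ e, ω e * α e * G.len e

/-- `d*` on integral 1-chains. -/
def dStarZ (α : G.E → ℤ) : G.V → ℤ := fun x =>
  (∑ e ∈ Finset.univ.filter fun e => G.head e = x, α e) -
    ∑ e ∈ Finset.univ.filter fun e => G.tail e = x, α e

/-- Integral 1-cycles. -/
def IsCycleZ (α : G.E → ℤ) : Prop := ∀ x, G.dStarZ α x = 0

/-- `α ∈ im(d)_ℤ`: `α` is an integral 1-chain which is the differential of a real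
function on the vertices (a function with integer slopes). -/
def IsExactZ (α : G.E → ℤ) : Prop :=
  ∃ f : G.V → ℝ, ∀ e, (α e : ℝ) = G.d f e

/-- The subgroup `H_1(G,ℤ) ⊕ im(d)_ℤ` of `C_1(G,ℤ)`, i.e. the subgroup generated by
integral cycles together with integral exact chains. -/
def jacRel : AddSubgroup (G.E → ℤ) :=
  AddSubgroup.closure {α | G.IsCycleZ α ∨ G.IsExactZ α}

/-- The Jacobian group of a weighted graph: `J(G) = C_1(G,ℤ)/(H_1(G,ℤ) ⊕ im(d)_ℤ)`. -/
def Jac := (G.E → ℤ) ⧸ G.jacRel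

noncomputable instance : AddCommGroup G.Jac :=
  inferInstanceAs (AddCommGroup ((G.E → ℤ) ⧸ G.jacRel))

/-- Divisors of degree zero. -/
def Div0 : AddSubgroup (G.V → ℤ) where
  carrier := {D | ∑ x, D x = 0}
  add_mem' := by
    intro a b ha hb
    simp only [Set.mem_setOf_eq] at *
    simp [Finset.sum_add_distrib, ha, hb]
  zero_mem' := by simp
  neg_mem' := by
    intro a ha
    simp only [Set.mem_setOf_eq] at *
    simp [ha]

/-- `d*` as a group homomorphism on integral 1-chains. -/
def dStarZHom : (G.E → ℤ) →+ (G.V → ℤ) where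
  toFun := G.dStarZ
  map_zero' := by funext x; simp [dStarZ]
  map_add' := by
    intro a b
    funext x
    simp [dStarZ, Finset.sum_add_distrib]
    ring

/-- The subgroup `im(d)_ℤ` of `C_1(G,ℤ)`. -/
def imdZ : AddSubgroup (G.E → ℤ) where
  carrier := {α | G.IsExactZ α}
  add_mem' := by
    rintro a b ⟨f, hf⟩ ⟨g, hg⟩
    exact ⟨f + g, fun e => by
      simp only [Pi.add_apply, Int.cast_add, hf e, hg e, d]; ring⟩
  zero_mem' := ⟨0, fun e => by simp [d]⟩
  neg_mem' := by
    rintro a ⟨f, hf⟩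
    exact ⟨-f, fun e => by
      simp only [Pi.neg_apply, Int.cast_neg, hf e, d]; ring⟩

/-- Principal divisors: `Prin(G) = d*(im(d)_ℤ)`. -/
def Prin : AddSubgroup (G.V → ℤ) := G.imdZ.map G.dStarZHom

lemma sum_dStarZ (α : G.E → ℤ) : ∑ x, G.dStarZ α x = 0 := by
  simp only [dStarZ, Finset.sum_sub_distrib]
  rw [Finset.sum_fiberwise, Finset.sum_fiberwise]
  simp

/-- The degree-zero Picard group `Pic(G) = Div⁰(G)/Prin(G)`. -/
def PicZ := G.Div0 ⧸ (G.Prin.addSubgroupOf G.Div0)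

noncomputable instance : AddCommGroup G.PicZ :=
  inferInstanceAs (AddCommGroup (G.Div0 ⧸ (G.Prin.addSubgroupOf G.Div0)))

/-- The weighted graph obtained by deleting the edge `e₀`. -/
def delEdge (e₀ : G.E) : WGraph where
  V := G.V
  E := {e : G.E // e ≠ e₀}
  tail := fun e => G.tail e.1
  head := fun e => G.head e.1
  len := fun e => G.len e.1
  len_pos := fun e => G.len_pos e.1

/-- An edge is a bridge if deleting it disconnects the graph. -/
def IsBridge (e₀ : G.E) : Prop := ¬ (G.delEdge e₀).Connected

/-- The weighted graph obtained by deleting a vertex `z` (and all incident edges). -/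
def delVertex (z : G.V) : WGraph where
  V := {x : G.V // x ≠ z}
  E := {e : G.E // G.tail e ≠ z ∧ G.head e ≠ z}
  tail := fun e => ⟨G.tail e.1, e.2.1⟩
  head := fun e => ⟨G.head e.1, e.2.2⟩
  len := fun e => G.len e.1
  len_pos := fun e => G.len_pos e.1

open scoped Classical in
/-- The (discrete) potential kernel: `jKer z y` is the function `f` with `f(z) = 0`
and `Δf = δ_y - δ_z` (when such a function exists; it is unique on a
connected graph). -/
noncomputable def jKer (z y : G.V) : G.V → ℝ :=
  if h : ∃ f : G.V → ℝ, f z = 0 ∧ ∀ w, G.dStar (G.d f) w =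
      (if w = y then 1 else 0) - (if w = z then 1 else 0)
  then h.choose else 0

/-- Connectivity using only the edges in `S`. -/
def ConnectedOn (S : Finset G.E) : Prop :=
  ∀ x y : G.V, Relation.ReflTransGen
    (fun a b => ∃ e ∈ S, (G.tail e = a ∧ G.head e = b) ∨ (G.tail e = b ∧ G.head e = a)) x y

/-- A spanning tree: a spanning connected edge set with `#V - 1` edges. -/
def IsSpanningTree (T : Finset G.E) : Prop :=
  G.ConnectedOn T ∧ T.card + 1 = Fintype.card G.V

/-- The weight `w(T) = Π_{e ∉ T} ℓ(e)` of a spanning tree. -/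
noncomputable def wt (T : Finset G.E) : ℝ := ∏ e ∈ Finset.univ \ T, G.len e

open scoped Classical in
/-- `w(G) = Σ_T w(T)`, summed over all spanning trees. -/
noncomputable def wG : ℝ := ∑ T : Finset G.E, if G.IsSpanningTree T then G.wt T else 0

open scoped Classical in
/-- The Foster coefficient `F(e) = (1/w(G)) Σ_{T : e ∉ T} w(T)`. -/
noncomputable def foster (e : G.E) : ℝ :=
  (1 / G.wG) * ∑ T : Finset G.E, if G.IsSpanningTree T ∧ e ∉ T then G.wt T else 0

open scoped Classical in
/-- The fundamental cycle `α_{T,e}`: the unique 1-cycle supported on `T ∪ {e}` taking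
the value `1` on `e`; by convention it is `0` when no such cycle exists
(e.g. when `e ∈ T`). -/
noncomputable def fundCycle (T : Finset G.E) (e : G.E) : G.E → ℝ :=
  if h : ∃ α : G.E → ℝ, G.IsCycle α ∧ α e = 1 ∧ ∀ f, f ∉ T → f ≠ e → α f = 0
  then h.choose else 0

end WGraph

namespace WGraph

/-- The pointed sum (wedge) of two weighted graphs `G₁`, `G₂`, identifying the
basepoint `p₂ ∈ G₂` with the basepoint `p₁ ∈ G₁`. -/
def wedge (G₁ G₂ : WGraph) (p₁ : G₁.V) (p₂ : G₂.V) : WGraph where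
  V := {x : G₁.V ⊕ G₂.V // x ≠ Sum.inr p₂}
  E := G₁.E ⊕ G₂.E
  tail := fun e => match e with
    | Sum.inl e => ⟨Sum.inl (G₁.tail e), by simp⟩
    | Sum.inr e =>
      if h : G₂.tail e = p₂ then ⟨Sum.inl p₁, by simp⟩
      else ⟨Sum.inr (G₂.tail e), by simpa using h⟩
  head := fun e => match e with
    | Sum.inl e => ⟨Sum.inl (G₁.head e), by simp⟩
    | Sum.inr e =>
      if h : G₂.head e = p₂ then ⟨Sum.inl p₁, by simp⟩
      else ⟨Sum.inr (G₂.head e), by simpa using h⟩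
  len := Sum.elim G₁.len G₂.len
  len_pos := by
    rintro (e | e)
    · exact G₁.len_pos e
    · exact G₂.len_pos e

end WGraph

namespace WGraph

section JacPic

variable (G : WGraph)

lemma dStarZHom_single (e : G.E) :
    G.dStarZHom (Pi.single e 1) = Pi.single (G.head e) 1 - Pi.single (G.tail e) 1 := by
  funext x
  simp [dStarZHom, dStarZ, Pi.single_apply, eq_comm]

lemma sum_dStarZ_mul (α : G.E → ℤ) (f : G.V → ℤ) :
    ∑ x, G.dStarZ α x * f x = ∑ e, α e * (f (G.head e) - f (G.tail e)) := by
  simp only [dStarZ, Finset.sum_filter, sub_mul, mul_sub, Finset.sum_sub_distrib, Finset.sum_mul,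
    ite_mul, zero_mul]
  congr 1 <;>
  · rw [Finset.sum_comm]
    simp

lemma isCycleZ_iff_forall_sum_eq_zero (α : G.E → ℤ) :
    G.IsCycleZ α ↔ ∀ f : G.V → ℤ, ∑ e, α e * (f (G.head e) - f (G.tail e)) = 0 := by
  constructor
  · intro h f
    rw [← sum_dStarZ_mul]
    exact Finset.sum_eq_zero fun x _ => by rw [h x, zero_mul]
  · intro h x
    have := h (Pi.single x 1)
    rw [← sum_dStarZ_mul] at this
    simpa [Pi.single_apply] using this

lemma jacRel_eq_sup : G.jacRel = G.imdZ ⊔ G.dStarZHom.ker := by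
  have h : {α | G.IsCycleZ α ∨ G.IsExactZ α} =
      ((G.imdZ : Set (G.E → ℤ)) ∪ (G.dStarZHom.ker : Set (G.E → ℤ))) := by
    ext α
    have : α ∈ G.dStarZHom.ker ↔ G.IsCycleZ α := by
      rw [AddMonoidHom.mem_ker]
      exact funext_iff
    simp only [Set.mem_ofPred_eq, Set.mem_union, SetLike.mem_coe, this, or_comm]
    rfl
  rw [jacRel, h, AddSubgroup.closure_union, AddSubgroup.closure_eq, AddSubgroup.closure_eq]

lemma mem_jacRel_iff (α : G.E → ℤ) :
    α ∈ G.jacRel ↔ ∃ β, G.IsExactZ β ∧ ∃ γ, G.IsCycleZ γ ∧ β + γ = α := by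
  rw [jacRel_eq_sup, AddSubgroup.mem_sup]
  simp only [AddMonoidHom.mem_ker, funext_iff (f := G.dStarZHom _)]
  rfl

variable {G}

lemma Connected.single_sub_single_mem_range (hG : G.Connected) (x y : G.V) :
    (Pi.single y 1 - Pi.single x 1 : G.V → ℤ) ∈ G.dStarZHom.range := by
  induction hG x y with
  | refl => simp
  | @tail b c _ hbc ih =>
    have hstep : (Pi.single c 1 - Pi.single b 1 : G.V → ℤ) ∈ G.dStarZHom.range := by
      obtain ⟨e, ⟨rfl, rfl⟩ | ⟨rfl, rfl⟩⟩ := hbc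
      · exact ⟨_, G.dStarZHom_single e⟩
      · exact ⟨-Pi.single e 1, by rw [map_neg, dStarZHom_single, neg_sub]⟩
    simpa using add_mem hstep ih

lemma Connected.range_dStarZHom (hG : G.Connected) : G.dStarZHom.range = G.Div0 := by
  apply le_antisymm
  · rintro _ ⟨α, rfl⟩
    exact G.sum_dStarZ α
  · intro D hD
    have hD : ∑ x, D x = 0 := hD
    obtain h | ⟨⟨p⟩⟩ := isEmpty_or_nonempty G.V
    · rw [Subsingleton.elim D 0]
      exact zero_mem _
    · have key : D = ∑ x, D x • (Pi.single x 1 - Pi.single p 1 : G.V → ℤ) := by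
        funext y
        simp [Finset.sum_apply, mul_sub, Finset.sum_sub_distrib, hD,
          Pi.single_apply]
      rw [key]
      exact sum_mem fun x _ => zsmul_mem (hG.single_sub_single_mem_range p x) _

/-- On a connected weighted graph, `d*` induces an isomorphism `J(G) ≃ Pic(G)`. -/
lemma Connected.nonempty_jac_equiv_picZ (hG : G.Connected) : Nonempty (G.Jac ≃+ G.PicZ) := by
  let δ : (G.E → ℤ) →+ G.Div0 := G.dStarZHom.codRestrict G.Div0 G.sum_dStarZ
  let φ : (G.E → ℤ) →+ G.Div0 ⧸ G.Prin.addSubgroupOf G.Div0 :=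
    (QuotientAddGroup.mk' (G.Prin.addSubgroupOf G.Div0)).comp δ
  have hδ : Function.Surjective δ := by
    rintro ⟨D, hD⟩
    rw [← hG.range_dStarZHom] at hD
    obtain ⟨α, rfl⟩ := hD
    exact ⟨α, rfl⟩
  have hφ : Function.Surjective φ :=
    (QuotientAddGroup.mk'_surjective (G.Prin.addSubgroupOf G.Div0)).comp hδ
  have hker : G.jacRel = φ.ker := by
    rw [jacRel_eq_sup, ← AddSubgroup.comap_map_eq]
    ext α
    rw [AddMonoidHom.mem_ker]
    exact (QuotientAddGroup.eq_zero_iff (N := G.Prin.addSubgroupOf G.Div0) (δ α)).symm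
  exact ⟨(QuotientAddGroup.quotientAddEquivOfEq hker).trans
    (QuotientAddGroup.quotientKerEquivOfSurjective φ hφ)⟩

end JacPic

section Wedge

variable (G₁ G₂ : WGraph) (p₁ : G₁.V) (p₂ : G₂.V)

/-- The inclusion of the first summand into the wedge. -/
def wedgeInl (x : G₁.V) : (wedge G₁ G₂ p₁ p₂).V := ⟨Sum.inl x, by simp⟩

/-- The inclusion of the second summand into the wedge. -/
def wedgeInr (y : G₂.V) : (wedge G₁ G₂ p₁ p₂).V :=
  if h : y = p₂ then ⟨Sum.inl p₁, by simp⟩ else ⟨Sum.inr y, by simpa using h⟩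

/-- The retraction of the wedge onto the first summand. -/
def wedgeFst (x : (wedge G₁ G₂ p₁ p₂).V) : G₁.V := Sum.elim id (fun _ => p₁) x.1

/-- The retraction of the wedge onto the second summand. -/
def wedgeSnd (x : (wedge G₁ G₂ p₁ p₂).V) : G₂.V := Sum.elim (fun _ => p₂) id x.1

@[simp] lemma wedgeFst_inl (x : G₁.V) : wedgeFst G₁ G₂ p₁ p₂ (wedgeInl G₁ G₂ p₁ p₂ x) = x := rfl

@[simp] lemma wedgeSnd_inl (x : G₁.V) : wedgeSnd G₁ G₂ p₁ p₂ (wedgeInl G₁ G₂ p₁ p₂ x) = p₂ := rfl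

lemma wedgeInr_base : wedgeInr G₁ G₂ p₁ p₂ p₂ = wedgeInl G₁ G₂ p₁ p₂ p₁ := dif_pos rfl

lemma wedgeInr_of_ne {y : G₂.V} (h : y ≠ p₂) :
    wedgeInr G₁ G₂ p₁ p₂ y = ⟨Sum.inr y, by simpa using h⟩ := dif_neg h

@[simp] lemma wedgeFst_inr (y : G₂.V) : wedgeFst G₁ G₂ p₁ p₂ (wedgeInr G₁ G₂ p₁ p₂ y) = p₁ := by
  obtain rfl | h := eq_or_ne y p₂
  · rw [wedgeInr_base, wedgeFst_inl]
  · rw [wedgeInr_of_ne G₁ G₂ p₁ p₂ h]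
    rfl

@[simp] lemma wedgeSnd_inr (y : G₂.V) : wedgeSnd G₁ G₂ p₁ p₂ (wedgeInr G₁ G₂ p₁ p₂ y) = y := by
  obtain rfl | h := eq_or_ne y p₂
  · rw [wedgeInr_base, wedgeSnd_inl]
  · rw [wedgeInr_of_ne G₁ G₂ p₁ p₂ h]
    rfl

@[simp] lemma wedge_head_inl (e : G₁.E) :
    (wedge G₁ G₂ p₁ p₂).head (Sum.inl e) = wedgeInl G₁ G₂ p₁ p₂ (G₁.head e) := rfl

@[simp] lemma wedge_tail_inl (e : G₁.E) :
    (wedge G₁ G₂ p₁ p₂).tail (Sum.inl e) = wedgeInl G₁ G₂ p₁ p₂ (G₁.tail e) := rfl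

@[simp] lemma wedge_head_inr (e : G₂.E) :
    (wedge G₁ G₂ p₁ p₂).head (Sum.inr e) = wedgeInr G₁ G₂ p₁ p₂ (G₂.head e) := rfl

@[simp] lemma wedge_len_inl (e : G₁.E) :
    (wedge G₁ G₂ p₁ p₂).len (Sum.inl e) = G₁.len e := rfl

@[simp] lemma wedge_len_inr (e : G₂.E) :
    (wedge G₁ G₂ p₁ p₂).len (Sum.inr e) = G₂.len e := rfl

@[simp] lemma wedge_tail_inr (e : G₂.E) :
    (wedge G₁ G₂ p₁ p₂).tail (Sum.inr e) = wedgeInr G₁ G₂ p₁ p₂ (G₂.tail e) := rfl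

lemma wedge_connected (h₁ : G₁.Connected) (h₂ : G₂.Connected) :
    (wedge G₁ G₂ p₁ p₂).Connected := by
  have hl (x y : G₁.V) : Relation.ReflTransGen (wedge G₁ G₂ p₁ p₂).Adj
      (wedgeInl G₁ G₂ p₁ p₂ x) (wedgeInl G₁ G₂ p₁ p₂ y) := by
    refine (h₁ x y).lift _ ?_
    rintro a b ⟨e, ⟨rfl, rfl⟩ | ⟨rfl, rfl⟩⟩
    · exact ⟨Sum.inl e, Or.inl ⟨rfl, rfl⟩⟩
    · exact ⟨Sum.inl e, Or.inr ⟨rfl, rfl⟩⟩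
  have hr (x y : G₂.V) : Relation.ReflTransGen (wedge G₁ G₂ p₁ p₂).Adj
      (wedgeInr G₁ G₂ p₁ p₂ x) (wedgeInr G₁ G₂ p₁ p₂ y) := by
    refine (h₂ x y).lift _ ?_
    rintro a b ⟨e, ⟨rfl, rfl⟩ | ⟨rfl, rfl⟩⟩
    · exact ⟨Sum.inr e, Or.inl ⟨rfl, rfl⟩⟩
    · exact ⟨Sum.inr e, Or.inr ⟨rfl, rfl⟩⟩
  have hcases (z : (wedge G₁ G₂ p₁ p₂).V) :
      (∃ x, z = wedgeInl G₁ G₂ p₁ p₂ x) ∨ ∃ y, z = wedgeInr G₁ G₂ p₁ p₂ y := by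
    obtain ⟨x | y, hz⟩ := z
    · exact Or.inl ⟨x, rfl⟩
    · exact Or.inr ⟨y, (wedgeInr_of_ne G₁ G₂ p₁ p₂ fun h => hz (congrArg Sum.inr h)).symm⟩
  intro z w
  obtain ⟨x, rfl⟩ | ⟨x, rfl⟩ := hcases z <;> obtain ⟨y, rfl⟩ | ⟨y, rfl⟩ := hcases w
  · exact hl x y
  · exact (hl x p₁).trans (wedgeInr_base G₁ G₂ p₁ p₂ ▸ hr p₂ y)
  · exact (hr x p₂).trans ((wedgeInr_base G₁ G₂ p₁ p₂).symm ▸ hl p₁ y)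
  · exact hr x y

lemma wedge_isExactZ_iff (α : (wedge G₁ G₂ p₁ p₂).E → ℤ) :
    (wedge G₁ G₂ p₁ p₂).IsExactZ α ↔
      G₁.IsExactZ (fun e => α (Sum.inl e)) ∧ G₂.IsExactZ (fun e => α (Sum.inr e)) := by
  constructor
  · rintro ⟨f, hf⟩
    exact ⟨⟨fun x => f (wedgeInl G₁ G₂ p₁ p₂ x), fun e => hf (Sum.inl e)⟩,
      ⟨fun y => f (wedgeInr G₁ G₂ p₁ p₂ y), fun e => hf (Sum.inr e)⟩⟩
  · rintro ⟨⟨f, hf⟩, ⟨g, hg⟩⟩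
    refine ⟨fun x => f (wedgeFst G₁ G₂ p₁ p₂ x) + g (wedgeSnd G₁ G₂ p₁ p₂ x), ?_⟩
    rintro (e | e)
    · exact (hf e).trans (by simp [d])
    · exact (hg e).trans (by simp [d])

lemma wedge_isCycleZ_iff (α : (wedge G₁ G₂ p₁ p₂).E → ℤ) :
    (wedge G₁ G₂ p₁ p₂).IsCycleZ α ↔
      G₁.IsCycleZ (fun e => α (Sum.inl e)) ∧ G₂.IsCycleZ (fun e => α (Sum.inr e)) := by
  have hsum (f : (wedge G₁ G₂ p₁ p₂).V → ℤ) :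
      ∑ e, α e * (f ((wedge G₁ G₂ p₁ p₂).head e) - f ((wedge G₁ G₂ p₁ p₂).tail e)) =
        ∑ e, α (Sum.inl e) * (f (wedgeInl G₁ G₂ p₁ p₂ (G₁.head e)) -
          f (wedgeInl G₁ G₂ p₁ p₂ (G₁.tail e))) +
        ∑ e, α (Sum.inr e) * (f (wedgeInr G₁ G₂ p₁ p₂ (G₂.head e)) -
          f (wedgeInr G₁ G₂ p₁ p₂ (G₂.tail e))) :=
    Fintype.sum_sum_type _
  rw [isCycleZ_iff_forall_sum_eq_zero, isCycleZ_iff_forall_sum_eq_zero,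
    isCycleZ_iff_forall_sum_eq_zero]
  constructor
  · intro h
    refine ⟨fun f => ?_, fun f => ?_⟩
    · simpa using (hsum fun x => f (wedgeFst G₁ G₂ p₁ p₂ x)).symm.trans (h fun x => f (wedgeFst G₁ G₂ p₁ p₂ x))
    · simpa using (hsum fun x => f (wedgeSnd G₁ G₂ p₁ p₂ x)).symm.trans (h fun x => f (wedgeSnd G₁ G₂ p₁ p₂ x))
  · rintro ⟨h₁, h₂⟩ f
    refine (hsum f).trans ?_
    rw [h₁ fun x => f (wedgeInl G₁ G₂ p₁ p₂ x), h₂ fun y => f (wedgeInr G₁ G₂ p₁ p₂ y), add_zero]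

lemma wedge_mem_jacRel_iff (α : (wedge G₁ G₂ p₁ p₂).E → ℤ) :
    α ∈ (wedge G₁ G₂ p₁ p₂).jacRel ↔
      (fun e => α (Sum.inl e)) ∈ G₁.jacRel ∧ (fun e => α (Sum.inr e)) ∈ G₂.jacRel := by
  simp only [mem_jacRel_iff]
  constructor
  · rintro ⟨β, hβ, γ, hγ, rfl⟩
    obtain ⟨hβ₁, hβ₂⟩ := (wedge_isExactZ_iff G₁ G₂ p₁ p₂ β).1 hβ
    obtain ⟨hγ₁, hγ₂⟩ := (wedge_isCycleZ_iff G₁ G₂ p₁ p₂ γ).1 hγ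
    exact ⟨⟨_, hβ₁, _, hγ₁, rfl⟩, ⟨_, hβ₂, _, hγ₂, rfl⟩⟩
  · rintro ⟨⟨β₁, hβ₁, γ₁, hγ₁, h₁⟩, ⟨β₂, hβ₂, γ₂, hγ₂, h₂⟩⟩
    refine ⟨Sum.elim β₁ β₂, (wedge_isExactZ_iff G₁ G₂ p₁ p₂ _).2 ⟨hβ₁, hβ₂⟩,
      Sum.elim γ₁ γ₂, (wedge_isCycleZ_iff G₁ G₂ p₁ p₂ _).2 ⟨hγ₁, hγ₂⟩, ?_⟩
    funext e
    rcases e with e | e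
    · exact congrFun h₁ e
    · exact congrFun h₂ e

/-- The Jacobian of a wedge is the product of the Jacobians. -/
lemma nonempty_jac_wedge_equiv :
    Nonempty ((wedge G₁ G₂ p₁ p₂).Jac ≃+ G₁.Jac × G₂.Jac) := by
  let φ : ((wedge G₁ G₂ p₁ p₂).E → ℤ) →+ ((G₁.E → ℤ) ⧸ G₁.jacRel) × ((G₂.E → ℤ) ⧸ G₂.jacRel) :=
    { toFun := fun α => (QuotientAddGroup.mk fun e => α (Sum.inl e),
        QuotientAddGroup.mk fun e => α (Sum.inr e))
      map_zero' := rfl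
      map_add' := fun _ _ => rfl }
  have hφ : Function.Surjective φ := by
    rintro ⟨a, b⟩
    obtain ⟨α, rfl⟩ := QuotientAddGroup.mk_surjective a
    obtain ⟨β, rfl⟩ := QuotientAddGroup.mk_surjective b
    exact ⟨Sum.elim α β, rfl⟩
  have hker : (wedge G₁ G₂ p₁ p₂).jacRel = φ.ker := by
    ext α
    rw [AddMonoidHom.mem_ker, Prod.ext_iff]
    exact (wedge_mem_jacRel_iff G₁ G₂ p₁ p₂ α).trans
      (and_congr (QuotientAddGroup.eq_zero_iff _).symm (QuotientAddGroup.eq_zero_iff _).symm)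
  exact ⟨(QuotientAddGroup.quotientAddEquivOfEq hker).trans
    (QuotientAddGroup.quotientKerEquivOfSurjective φ hφ)⟩

end Wedge

end WGraph

/-- If `G` is the pointed sum of `G₁` and `G₂` (meeting in a single
vertex), then `Pic(G) ≅ Pic(G₁) × Pic(G₂)` and, equivalently,
`J(G) ≅ J(G₁) × J(G₂)`. -/
theorem pic_wedge (G₁ G₂ : WGraph) (p₁ : G₁.V) (p₂ : G₂.V)
    (h₁ : G₁.Connected) (h₂ : G₂.Connected) :
    Nonempty ((WGraph.wedge G₁ G₂ p₁ p₂).PicZ ≃+ G₁.PicZ × G₂.PicZ) ∧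
    Nonempty ((WGraph.wedge G₁ G₂ p₁ p₂).Jac ≃+ G₁.Jac × G₂.Jac) := by
  obtain ⟨φ⟩ := WGraph.nonempty_jac_wedge_equiv G₁ G₂ p₁ p₂
  obtain ⟨ψ⟩ := (WGraph.wedge_connected G₁ G₂ p₁ p₂ h₁ h₂).nonempty_jac_equiv_picZ
  obtain ⟨ψ₁⟩ := h₁.nonempty_jac_equiv_picZ
  obtain ⟨ψ₂⟩ := h₂.nonempty_jac_equiv_picZ
  exact ⟨⟨ψ.symm.trans (φ.trans (ψ₁.prodCongr ψ₂))⟩, ⟨φ⟩⟩
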